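/- Let X be a Polish space, I a countable index set, (f_y)_{y∈I} a family of measurable functions f_y : X → ℝ₊, and M a positively associated random measure on X. Define the random field (X_y)_{y∈I} by X_y := ∫ f_y(x) M(dx). Then (X_y)_{y∈I} is a positively associated family of [0, ∞]-valued random variables. -/

import Mathlib

open MeasureTheory

/-- The partial order on (Radon) measures on a metric space:
`μ ≤ ν` iff `μ B ≤ ν B` for every bounded Borel set `B`. -/
def MeasLE {S : Type*} [MeasurableSpace S] [MetricSpace S] (μ ν : Measure S) : Prop :=
  ∀ B : Set S, MeasurableSet B → Bornology.IsBounded B → μ B ≤ ν B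

/-- A function on measures is nondecreasing w.r.t. the order `MeasLE`. -/
def MeasMono {S : Type*} [MeasurableSpace S] [MetricSpace S] (F : Measure S → ℝ) : Prop :=
  ∀ μ ν, MeasLE μ ν → F μ ≤ F ν

/-- A function on measures is measurable with respect to a set `A ⊆ S` if it only depends
on the restriction of its argument to `A`. -/
def MeasurableWrt {S : Type*} [MeasurableSpace S] (A : Set S) (F : Measure S → ℝ) : Prop :=
  ∀ μ : Measure S, F μ = F (μ.restrict A)

/-- A random measure `M` is *negatively associated* if
`E[F(M) G(M)] ≤ E[F(M)] E[G(M)]` for every pair `F, G` of bounded nondecreasing measurable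
functions on measures that are measurable with respect to disjoint measurable subsets of `S`. -/
def RMNegAssoc {Ω S : Type*} [MeasurableSpace Ω] [MeasurableSpace S] [MetricSpace S]
    (P : Measure Ω) (M : Ω → Measure S) : Prop :=
  ∀ (A B : Set S), MeasurableSet A → MeasurableSet B → Disjoint A B →
    ∀ F G : Measure S → ℝ,
      Measurable F → MeasMono F → (∃ C, ∀ μ, |F μ| ≤ C) → MeasurableWrt A F →
      Measurable G → MeasMono G → (∃ C, ∀ μ, |G μ| ≤ C) → MeasurableWrt B G →
      ∫ ω, F (M ω) * G (M ω) ∂P ≤ (∫ ω, F (M ω) ∂P) * ∫ ω, G (M ω) ∂P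

/-- A random measure `M` is *positively associated* if
`E[F(M) G(M)] ≥ E[F(M)] E[G(M)]` for every pair `F, G` of bounded nondecreasing
measurable functions on measures. -/
def RMPosAssoc {Ω S : Type*} [MeasurableSpace Ω] [MeasurableSpace S] [MetricSpace S]
    (P : Measure Ω) (M : Ω → Measure S) : Prop :=
  ∀ F G : Measure S → ℝ,
    Measurable F → MeasMono F → (∃ C, ∀ μ, |F μ| ≤ C) →
    Measurable G → MeasMono G → (∃ C, ∀ μ, |G μ| ≤ C) →
    (∫ ω, F (M ω) ∂P) * ∫ ω, G (M ω) ∂P ≤ ∫ ω, F (M ω) * G (M ω) ∂P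

/-- A countable topological dissecting semi-ring of bounded Borel sets generating the
Borel σ-field, as in Kallenberg's theory of random measures: a countable semi-ring of
bounded Borel sets such that every open set is a countable union of its members, every
bounded set is covered by finitely many of its members, and it generates the Borel
σ-field. -/
structure IsDissectingSemiring {S : Type*} [MeasurableSpace S] [MetricSpace S]
    (I : Set (Set S)) : Prop where
  countable : I.Countable
  measurableSet : ∀ B ∈ I, MeasurableSet B
  isBounded : ∀ B ∈ I, Bornology.IsBounded B
  empty_mem : ∅ ∈ I
  inter_mem : ∀ A ∈ I, ∀ B ∈ I, A ∩ B ∈ I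
  diff_eq_disjoint_sUnion : ∀ A ∈ I, ∀ B ∈ I, ∃ F : Finset (Set S),
    ↑F ⊆ I ∧ (F : Set (Set S)).Pairwise Disjoint ∧ A \ B = ⋃₀ ↑F
  isOpen_eq_sUnion : ∀ G : Set S, IsOpen G →
    ∃ C : Set (Set S), C ⊆ I ∧ C.Countable ∧ G = ⋃₀ C
  isBounded_covered : ∀ B : Set S, Bornology.IsBounded B →
    ∃ F : Finset (Set S), ↑F ⊆ I ∧ B ⊆ ⋃₀ ↑F
  generateFrom_eq : MeasurableSpace.generateFrom I = ‹MeasurableSpace S›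

/-- Negative association of finite-dimensional random vectors, with values in `ℝ≥0∞`. -/
def NegAssoc {Ω ι X : Type*} [MeasurableSpace Ω] [MeasurableSpace X] [Preorder X]
    (P : Measure Ω) (Xs : ι → Ω → X) : Prop :=
  ∀ (J : Set ι) (f : (J → X) → ℝ) (g : ((Jᶜ : Set ι) → X) → ℝ),
    Measurable f → Monotone f → (∃ C, ∀ x, |f x| ≤ C) →
    Measurable g → Monotone g → (∃ C, ∀ x, |g x| ≤ C) →
    ∫ ω, f (fun j => Xs j.1 ω) * g (fun j => Xs j.1 ω) ∂P ≤
      (∫ ω, f (fun j => Xs j.1 ω) ∂P) * ∫ ω, g (fun j => Xs j.1 ω) ∂P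

/-- Positive association of a family of random elements of a partially ordered measurable
space. -/
def PosAssoc {Ω ι X : Type*} [MeasurableSpace Ω] [MeasurableSpace X] [Preorder X]
    (P : Measure Ω) (Xs : ι → Ω → X) : Prop :=
  ∀ (J : Set ι) (f g : (J → X) → ℝ),
    Measurable f → Monotone f → (∃ C, ∀ x, |f x| ≤ C) →
    Measurable g → Monotone g → (∃ C, ∀ x, |g x| ≤ C) →
    (∫ ω, f (fun j => Xs j.1 ω) ∂P) * ∫ ω, g (fun j => Xs j.1 ω) ∂P ≤
      ∫ ω, f (fun j => Xs j.1 ω) * g (fun j => Xs j.1 ω) ∂P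

/-- The order on measures given by bounded Borel sets implies the usual order. -/
theorem MeasLE.le {S : Type*} [MeasurableSpace S] [MetricSpace S] [OpensMeasurableSpace S]
    {μ ν : Measure S} (h : MeasLE μ ν) : μ ≤ ν := by
  refine Measure.le_iff.2 fun B hB => ?_
  rcases isEmpty_or_nonempty S with hS | ⟨⟨x⟩⟩
  · simp [Set.eq_empty_of_isEmpty B]
  have hmono : Monotone fun n : ℕ => B ∩ Metric.closedBall x n := fun m n hmn =>
    Set.inter_subset_inter_right B (Metric.closedBall_subset_closedBall (Nat.cast_le.2 hmn))
  have hU : B = ⋃ n : ℕ, B ∩ Metric.closedBall x n := by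
    rw [← Set.inter_iUnion, Metric.iUnion_closedBall_nat, Set.inter_univ]
  rw [hU, hmono.measure_iUnion, hmono.measure_iUnion]
  exact iSup_mono fun n => h _ (hB.inter Metric.isClosed_closedBall.measurableSet)
    (Metric.isBounded_closedBall.subset Set.inter_subset_right)

/-- **Random integrals of a positively associated random measure.** If `M` is a
positively associated random measure on a Polish space `X` and `(f y)_{y ∈ ι}` is a
countable family of nonnegative measurable functions on `X`, then the random field
`X_y := ∫ f_y dM` is a positively associated family of `[0, ∞]`-valued random
variables. -/
theorem posAssoc_random_integrals
    {Ω X ι : Type*} [MeasurableSpace Ω] [Countable ι]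
    [MetricSpace X] [CompleteSpace X] [SecondCountableTopology X]
    [MeasurableSpace X] [BorelSpace X]
    (P : Measure Ω) [IsProbabilityMeasure P]
    (M : Ω → Measure X) (hMmeas : Measurable M)
    (hRadon : ∀ ω, ∀ B : Set X, Bornology.IsBounded B → M ω B < ⊤)
    (hPA : RMPosAssoc P M)
    (f : ι → X → NNReal) (hf : ∀ y, Measurable (f y)) :
    PosAssoc P (fun y ω => ∫⁻ x, (f y x : ENNReal) ∂(M ω)) := by
  intro J φ ψ hφ hφ_mono hφ_bdd hψ hψ_mono hψ_bdd
  let Φ : Measure X → J → ENNReal := fun μ j => ∫⁻ x, (f j x : ENNReal) ∂μ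
  have hΦ : Measurable Φ := measurable_pi_lambda _ fun j =>
    Measure.measurable_lintegral (hf j).coe_nnreal_ennreal
  have hΦ_mono : ∀ μ ν, MeasLE μ ν → Φ μ ≤ Φ ν := fun μ ν h j => lintegral_mono' h.le le_rfl
  exact hPA (φ ∘ Φ) (ψ ∘ Φ)
    (hφ.comp hΦ) (fun μ ν h => hφ_mono (hΦ_mono μ ν h)) (hφ_bdd.imp fun _ h μ => h (Φ μ))
    (hψ.comp hΦ) (fun μ ν h => hψ_mono (hΦ_mono μ ν h)) (hψ_bdd.imp fun _ h μ => h (Φ μ))
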